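/- Let (X, D) be a metric space, μ : X → ℝ a 1-Lipschitz function, and x* ∈ X with μ(x*) ≥ μ(x) for all x ∈ X; write μ* = μ(x*). Let A ⊆ X be a finite nonempty set, ε > 0, and μ̂ : A → ℝ with |μ̂(x) − μ(x)| ≤ ε for all x ∈ A. Suppose x₀ ∈ A satisfies μ̂(x₀) ≥ max_{x∈A} μ̂(x) − 3ε (x₀ survives elimination), x ∈ X satisfies D(x, x₀) ≤ ε, and there exists x** ∈ A with D(x*, x**) ≤ ε. Then the optimality gap of x is bounded: μ* − μ(x) ≤ 7ε. -/

import Mathlib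

/-- Under the clean event, any arm `x` within distance `ε` of a
point `x₀ ∈ A` that survives the elimination rule has optimality gap at most
`7ε`, provided the optimal arm `x*` is within distance `ε` of some point of `A`. -/
theorem gap_le_seven_eps {X : Type*} [MetricSpace X]
    (μ : X → ℝ) (hμ : LipschitzWith 1 μ)
    (xstar : X) (hmax : ∀ x, μ x ≤ μ xstar)
    (A : Finset X) (hA : A.Nonempty) (ε : ℝ) (hε : 0 < ε)
    (μhat : X → ℝ) (hest : ∀ x ∈ A, |μhat x - μ x| ≤ ε)
    (x₀ : X) (hx₀ : x₀ ∈ A) (hsurv : A.sup' hA μhat - 3 * ε ≤ μhat x₀)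
    (x : X) (hx : dist x x₀ ≤ ε)
    (hcov : ∃ xss ∈ A, dist xstar xss ≤ ε) :
    μ xstar - μ x ≤ 7 * ε := by
  obtain ⟨y, hy, hdy⟩ := hcov
  have h_sup : μhat y ≤ A.sup' hA μhat := A.le_sup' μhat hy
  have h_star := hμ.dist_le_mul xstar y
  have h_near := hμ.dist_le_mul x x₀
  rw [NNReal.coe_one, one_mul, Real.dist_eq] at h_star h_near
  have h_est_y := abs_le.mp (hest y hy)
  have h_est_x₀ := abs_le.mp (hest x₀ hx₀)
  have h_lip_star := abs_le.mp h_star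
  have h_lip_near := abs_le.mp h_near
  linarith [h_est_y.1, h_est_x₀.2, h_lip_star.2, h_lip_near.1]
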